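/- arXiv:1509.07600 — 4 statements merged into one kernel-verified Lean document; each statement's English description precedes it below -/
import Mathlib

section
/- Let ρ_0 = 0 and, for m = 1, …, k, let ρ_m be the LARGEST index j ∈ {ρ_{m−1}+1, …, h} maximizing τ(v_h − v_j) + (Σ_{l=ρ_{m−1}+1}^{j} w_l)/c (so ρ_k = h). Then for every m ∈ {2, …, k}, the strict inequality τ(v_{ρ_m} − v_{ρ_{m−1}}) > σ_m / c holds, where σ_m = Σ_{l=ρ_{m−1}+1}^{ρ_m} w_l. -/
open Finset
open scoped Classical

namespace DPN

noncomputable def score (τ c : ℝ) (v w : ℕ → ℝ) (h r j : ℕ) : ℝ :=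
  τ * (v h - v j) + (∑ l ∈ Finset.Ioc r j, w l) / c

noncomputable def nextHead (τ c : ℝ) (v w : ℕ → ℝ) (h r : ℕ) : ℕ :=
  (((Finset.Ioc r h).filter (fun j =>
      ∀ j' ∈ Finset.Ioc r h, score τ c v w h r j' ≤ score τ c v w h r j)).max).getD h

noncomputable def heads (τ c : ℝ) (v w : ℕ → ℝ) (h : ℕ) : ℕ → ℕ
  | 0 => 0
  | m + 1 => nextHead τ c v w h (heads τ c v w h m)

noncomputable def hIdx (n : ℕ) (v : ℕ → ℝ) (x : ℝ) : ℕ :=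
  ((Finset.Icc 1 n).filter (fun i => v i < x)).card

noncomputable def phiL (n : ℕ) (τ c : ℝ) (v w : ℕ → ℝ) (x : ℝ) : ℝ :=
  ∑ m ∈ Finset.range n,
    ((∑ l ∈ Finset.Ioc (heads τ c v w (hIdx n v x) m) (heads τ c v w (hIdx n v x) (m + 1)), w l) *
        (τ * (x - v (heads τ c v w (hIdx n v x) (m + 1)))) +
      (∑ l ∈ Finset.Ioc (heads τ c v w (hIdx n v x) m) (heads τ c v w (hIdx n v x) (m + 1)), w l) ^ 2 /
        (2 * c))

def rv (n : ℕ) (v : ℕ → ℝ) : ℕ → ℝ := fun l => -v (n + 1 - l)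

def rw (n : ℕ) (w : ℕ → ℝ) : ℕ → ℝ := fun l => w (n + 1 - l)

noncomputable def phiR (n : ℕ) (τ c : ℝ) (v w : ℕ → ℝ) (x : ℝ) : ℝ :=
  phiL n τ c (rv n v) (rw n w) (-x)

noncomputable def phi (n : ℕ) (τ c : ℝ) (v w : ℕ → ℝ) (x : ℝ) : ℝ :=
  phiL n τ c v w x + phiR n τ c v w x

/-- The set of scenarios: each vertex weight lies in its interval. -/
def scenarios (n : ℕ) (wm wp : ℕ → ℝ) : Set (ℕ → ℝ) :=
  {s | ∀ i, 1 ≤ i → i ≤ n → wm i ≤ s i ∧ s i ≤ wp i}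

/-- The gap `Γ^s(x, y) = Φ^s(x) − Φ^s(y)`. -/
noncomputable def gap (n : ℕ) (τ c : ℝ) (v s : ℕ → ℝ) (x y : ℝ) : ℝ :=
  phi n τ c v s x - phi n τ c v s y

/-- The regret `R^s(x) = Φ^s(x) − Φ^s(m^s)` (`Φ^s(m^s)` = min of `Φ^s` on `[v_1, v_n]`). -/
noncomputable def regret (n : ℕ) (τ c : ℝ) (v s : ℕ → ℝ) (x : ℝ) : ℝ :=
  phi n τ c v s x - sInf ((fun z => phi n τ c v s z) '' Set.Icc (v 1) (v n))

/-- The maximum regret `R_max(x) = sup_{s ∈ S} R^s(x)`. -/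
noncomputable def maxRegret (n : ℕ) (τ c : ℝ) (v wm wp : ℕ → ℝ) (x : ℝ) : ℝ :=
  sSup {r | ∃ s ∈ scenarios n wm wp, r = regret n τ c v s x}

/-- The left-pseudo-bipartite scenario `s(i, w)`. -/
def pseudoBipL (wm wp : ℕ → ℝ) (i : ℕ) (w : ℝ) : ℕ → ℝ :=
  fun l => if l < i then wp l else if l = i then w else wm l

/-- The right-pseudo-bipartite scenario `s(i, w)`. -/
def pseudoBipR (wm wp : ℕ → ℝ) (i : ℕ) (w : ℝ) : ℕ → ℝ :=
  fun l => if l < i then wm l else if l = i then w else wp l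

/-- The head `ρ_m` of the left cluster containing vertex `i`: the smallest cluster head `≥ i`. -/
noncomputable def clusterHeadOf (τ c : ℝ) (v w : ℕ → ℝ) (h i : ℕ) : ℕ :=
  ((((Finset.range (h + 1)).image (heads τ c v w h)).filter (fun r => i ≤ r)).min).getD h

/-- The head `ρ_{m−1}` preceding the left cluster containing vertex `i`:
the largest cluster head `< i`. -/
noncomputable def prevClusterHeadOf (τ c : ℝ) (v w : ℕ → ℝ) (h i : ℕ) : ℕ :=
  ((((Finset.range (h + 1)).image (heads τ c v w h)).filter (fun r => r < i)).max).getD 0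

/-- The weight `σ_m` of the left cluster containing vertex `i`. -/
noncomputable def clusterWeightOf (τ c : ℝ) (v w : ℕ → ℝ) (h i : ℕ) : ℝ :=
  ∑ l ∈ Finset.Ioc (prevClusterHeadOf τ c v w h i) (clusterHeadOf τ c v w h i), w l

/-- The sequence of right cluster heads for the vertex `y = v_j`
(expressed in the coordinates of the reflected network). -/
noncomputable def rightHeads (n : ℕ) (τ c : ℝ) (v w : ℕ → ℝ) (j : ℕ) : ℕ → ℕ :=
  heads τ c (rv n v) (rw n w) (hIdx n (rv n v) (-(v j)))

/-- The sequence of left cluster heads for the vertex `y = v_j`. -/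
noncomputable def leftHeads (n : ℕ) (τ c : ℝ) (v w : ℕ → ℝ) (j : ℕ) : ℕ → ℕ :=
  heads τ c v w (hIdx n v (v j))

/-- The (original-coordinates) index of the head of the right cluster for `y = v_j`
containing vertex `i`. -/
noncomputable def rightClusterHeadOf (n : ℕ) (τ c : ℝ) (v w : ℕ → ℝ) (j i : ℕ) : ℕ :=
  n + 1 - clusterHeadOf τ c (rv n v) (rw n w) (hIdx n (rv n v) (-(v j))) (n + 1 - i)

/-- The weight of the right cluster for `y = v_j` containing vertex `i`. -/
noncomputable def rightClusterWeightOf (n : ℕ) (τ c : ℝ) (v w : ℕ → ℝ) (j i : ℕ) : ℝ :=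
  clusterWeightOf τ c (rv n v) (rw n w) (hIdx n (rv n v) (-(v j))) (n + 1 - i)

/-- `ω` is a critical weight for `v_i` with respect to the vertex `y = v_j`
(left-pseudo-bipartite case): `ω ∈ {w_i^−, w_i^+}` or the right-cluster partition for `y`
under `s(i, ·)` is not constant on any neighborhood of `ω` in `[w_i^−, w_i^+]`. -/
def criticalWeightL (n : ℕ) (τ c : ℝ) (v wm wp : ℕ → ℝ) (j i : ℕ) (ω : ℝ) : Prop :=
  ω ∈ Set.Icc (wm i) (wp i) ∧
    (ω = wm i ∨ ω = wp i ∨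
      ¬ ∃ ε > (0 : ℝ), ∀ w ∈ Set.Icc (wm i) (wp i), |w - ω| < ε →
        rightHeads n τ c v (pseudoBipL wm wp i w) j =
          rightHeads n τ c v (pseudoBipL wm wp i ω) j)

/-- `ω` is a critical weight for `v_i` with respect to the vertex `y = v_j`
(right-pseudo-bipartite case, using the left-cluster partition for `y`). -/
def criticalWeightR (n : ℕ) (τ c : ℝ) (v wm wp : ℕ → ℝ) (j i : ℕ) (ω : ℝ) : Prop :=
  ω ∈ Set.Icc (wm i) (wp i) ∧
    (ω = wm i ∨ ω = wp i ∨
      ¬ ∃ ε > (0 : ℝ), ∀ w ∈ Set.Icc (wm i) (wp i), |w - ω| < ε →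
        leftHeads n τ c v (pseudoBipR wm wp i w) j =
          leftHeads n τ c v (pseudoBipR wm wp i ω) j)

/-- `Q`: the number of right clusters for `y = v_j` under weights `w` that lie entirely
to the right of the right cluster containing `v_i` (counted via reflected cluster heads). -/
noncomputable def Qnum (n : ℕ) (τ c : ℝ) (v w : ℕ → ℝ) (j i : ℕ) : ℕ :=
  (((Finset.range (n + 1)).image (rightHeads n τ c v w j)).filter
      (fun r => 1 ≤ r ∧
        r < clusterHeadOf τ c (rv n v) (rw n w) (hIdx n (rv n v) (-(v j))) (n + 1 - i))).card

end DPN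

open DPN

/-- The next head is the last maximizer of the score over the remaining vertices. -/
theorem DPN.nextHead_spec (τ c : ℝ) (v w : ℕ → ℝ) {h r : ℕ} (hr : r < h) :
    nextHead τ c v w h r ∈ Finset.Ioc r h ∧
      ∀ j ∈ Finset.Ioc r h, nextHead τ c v w h r < j →
        score τ c v w h r j < score τ c v w h r (nextHead τ c v w h r) := by
  set S := (Finset.Ioc r h).filter (fun j =>
    ∀ j' ∈ Finset.Ioc r h, score τ c v w h r j' ≤ score τ c v w h r j) with hS
  have hne : S.Nonempty := by
    obtain ⟨a, ha, hmax⟩ := Finset.exists_max_image (Finset.Ioc r h) (score τ c v w h r)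
      (Finset.nonempty_Ioc.2 hr)
    exact ⟨a, Finset.mem_filter.2 ⟨ha, hmax⟩⟩
  obtain ⟨a, ha⟩ := Finset.max_of_nonempty hne
  have hnext : nextHead τ c v w h r = a := by
    change S.max.getD h = a
    rw [ha]
    rfl
  obtain ⟨hmem, hmax⟩ := Finset.mem_filter.1 (Finset.mem_of_max ha)
  rw [hnext]
  refine ⟨hmem, fun j hj haj => ?_⟩
  by_contra! hle
  have hjS : j ∈ S := Finset.mem_filter.2 ⟨hj, fun j' hj' => (hmax j' hj').trans hle⟩
  exact haj.not_ge (Finset.le_max_of_eq hjS ha)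

theorem DPN.nextHead_of_le (τ c : ℝ) (v w : ℕ → ℝ) {h r : ℕ} (hr : h ≤ r) :
    nextHead τ c v w h r = h := by
  rw [nextHead, Finset.Ioc_eq_empty_of_le hr, Finset.filter_empty, Finset.max_empty]
  rfl

theorem stmt0 (n : ℕ) (τ c : ℝ) (hτ : 0 < τ) (hc : 0 < c) (v : ℕ → ℝ)
    (hv : ∀ i, 1 ≤ i → i < n → v i < v (i + 1))
    (w : ℕ → ℝ) (hw : ∀ i, 1 ≤ i → i ≤ n → 0 < w i)
    (h : ℕ) (hh1 : 1 ≤ h) (hhn : h ≤ n)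
    (m : ℕ) (hm : heads τ c v w h (m + 1) < h) :
    τ * (v (heads τ c v w h (m + 2)) - v (heads τ c v w h (m + 1))) >
      (∑ l ∈ Finset.Ioc (heads τ c v w h (m + 1)) (heads τ c v w h (m + 2)), w l) / c := by
  have hlt : heads τ c v w h m < h := by
    by_contra! hle
    exact hm.ne (nextHead_of_le τ c v w hle)
  obtain ⟨hmem₁, hmax₁⟩ : heads τ c v w h (m + 1) ∈ Finset.Ioc (heads τ c v w h m) h ∧ _ :=
    nextHead_spec τ c v w hlt
  have hmem₂ : heads τ c v w h (m + 2) ∈ Finset.Ioc (heads τ c v w h (m + 1)) h :=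
    (nextHead_spec τ c v w hm).1
  rw [Finset.mem_Ioc] at hmem₁ hmem₂
  have hscore : score τ c v w h (heads τ c v w h m) (heads τ c v w h (m + 2)) <
      score τ c v w h (heads τ c v w h m) (heads τ c v w h (m + 1)) :=
    hmax₁ _ (Finset.mem_Ioc.2 ⟨hmem₁.1.trans hmem₂.1, hmem₂.2⟩) hmem₂.1
  rw [score, score, ← Finset.sum_Ioc_consecutive w hmem₁.1.le hmem₂.1.le, add_div] at hscore
  linarith
end

section
/- For any fixed positive weights w_1, …, w_n, there exists an index i ∈ {1, …, n} such that Φ(v_i) = min { Φ(x) : x ∈ [v_1, v_n] }; that is, the 1-median of the dynamic path network (a minimizer of the total evacuation time Φ) is attained at a vertex. -/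
open Finset
open scoped Classical

namespace DPN

/-- The contribution at `x` of the left cluster consisting of the vertices `r + 1, …, s`. -/
noncomputable def clusterCost (τ c : ℝ) (v w : ℕ → ℝ) (x : ℝ) (r s : ℕ) : ℝ :=
  (∑ l ∈ Finset.Ioc r s, w l) * (τ * (x - v s)) + (∑ l ∈ Finset.Ioc r s, w l) ^ 2 / (2 * c)

/-- The cost at `x` of the first `N` left clusters formed by the vertices `r + 1, …, h`. -/
noncomputable def costFrom (τ c : ℝ) (v w : ℕ → ℝ) (h : ℕ) (x : ℝ) (N r : ℕ) : ℝ :=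
  ∑ m ∈ Finset.range N,
    clusterCost τ c v w x ((nextHead τ c v w h)^[m] r) ((nextHead τ c v w h)^[m + 1] r)

section

variable {τ c : ℝ} {v w : ℕ → ℝ}

theorem heads_eq_iterate (h m : ℕ) : heads τ c v w h m = (nextHead τ c v w h)^[m] 0 := by
  induction m with
  | zero => rfl
  | succ m ih => rw [Function.iterate_succ_apply', ← ih, heads]

theorem phiL_eq_costFrom (n : ℕ) (x : ℝ) :
    phiL n τ c v w x = costFrom τ c v w (hIdx n v x) x n 0 := by
  simp only [phiL, costFrom, clusterCost, heads_eq_iterate]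

@[simp]
theorem costFrom_zero (h r : ℕ) (x : ℝ) : costFrom τ c v w h x 0 r = 0 := by
  simp [costFrom]

theorem costFrom_succ (h N r : ℕ) (x : ℝ) :
    costFrom τ c v w h x (N + 1) r =
      clusterCost τ c v w x r (nextHead τ c v w h r) +
        costFrom τ c v w h x N (nextHead τ c v w h r) := by
  simp only [costFrom]
  rw [Finset.sum_range_succ', add_comm]
  simp only [Function.iterate_succ_apply, Function.iterate_zero_apply]

theorem costFrom_eq_affine (h N r : ℕ) :
    ∃ a b : ℝ, ∀ x, costFrom τ c v w h x N r = a * x + b := by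
  induction N generalizing r with
  | zero => exact ⟨0, 0, by simp⟩
  | succ N ih =>
    obtain ⟨a, b, hab⟩ := ih (nextHead τ c v w h r)
    set W := ∑ l ∈ Finset.Ioc r (nextHead τ c v w h r), w l with hW
    refine ⟨W * τ + a, W ^ 2 / (2 * c) - W * τ * v (nextHead τ c v w h r) + b, fun x => ?_⟩
    rw [costFrom_succ, hab, clusterCost, ← hW]
    ring

theorem score_le_score_iff {h r i j : ℕ} :
    score τ c v w h r i ≤ score τ c v w h r j ↔
      (∑ l ∈ Finset.Ioc r i, w l) / c - τ * v i ≤ (∑ l ∈ Finset.Ioc r j, w l) / c - τ * v j := by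
  simp only [score]
  constructor <;> intro h <;> linarith

theorem nextHead_self (h : ℕ) : nextHead τ c v w h h = h := by
  simp only [nextHead, Finset.Ioc_self, Finset.filter_empty, Finset.max_empty]
  rfl

theorem nextHead_isGreatest {h r : ℕ} (hr : r < h) :
    IsGreatest {j | (r < j ∧ j ≤ h) ∧
      ∀ i, r < i → i ≤ h → score τ c v w h r i ≤ score τ c v w h r j}
      (nextHead τ c v w h r) := by
  set S := (Finset.Ioc r h).filter (fun j =>
      ∀ j' ∈ Finset.Ioc r h, score τ c v w h r j' ≤ score τ c v w h r j) with hS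
  have mem_S : ∀ j, j ∈ S ↔ (r < j ∧ j ≤ h) ∧
      ∀ i, r < i → i ≤ h → score τ c v w h r i ≤ score τ c v w h r j := by
    intro j
    simp [hS]
  have hne : S.Nonempty := by
    obtain ⟨j, hj, hmax⟩ :=
      Finset.exists_max_image (Finset.Ioc r h) (score τ c v w h r) ⟨h, by simp [hr]⟩
    exact ⟨j, Finset.mem_filter.2 ⟨hj, hmax⟩⟩
  obtain ⟨a, ha⟩ := Finset.max_of_nonempty hne
  have hnext : nextHead τ c v w h r = a := by
    change S.max.getD h = a
    rw [ha]
    rfl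
  rw [hnext]
  exact ⟨(mem_S a).1 (Finset.mem_of_max ha),
    fun b hb => Finset.le_max_of_eq ((mem_S b).2 hb) ha⟩

theorem le_nextHead {h r : ℕ} (hr : r ≤ h) : r ≤ nextHead τ c v w h r := by
  rcases hr.eq_or_lt with rfl | hr
  · rw [nextHead_self]
  · exact (nextHead_isGreatest hr).1.1.1.le

theorem nextHead_le {h r : ℕ} (hr : r ≤ h) : nextHead τ c v w h r ≤ h := by
  rcases hr.eq_or_lt with rfl | hr
  · rw [nextHead_self]
  · exact (nextHead_isGreatest hr).1.1.2

theorem nextHead_succ_eq {h r : ℕ} (hr : r ≤ h) (hne : nextHead τ c v w (h + 1) r ≠ h + 1) :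
    nextHead τ c v w (h + 1) r = nextHead τ c v w h r := by
  obtain ⟨⟨⟨hlt, hle⟩, hmax⟩, hub⟩ :=
    nextHead_isGreatest (τ := τ) (c := c) (v := v) (w := w) (Nat.lt_add_one_of_le hr)
  have hle' : nextHead τ c v w (h + 1) r ≤ h := by omega
  obtain ⟨⟨⟨hlt₀, hle₀⟩, hmax₀⟩, hub₀⟩ :=
    nextHead_isGreatest (τ := τ) (c := c) (v := v) (w := w) (hlt.trans_le hle')
  refine le_antisymm (hub₀ ⟨⟨hlt, hle'⟩, fun i hi hih => ?_⟩)
    (hub ⟨⟨hlt₀, by omega⟩, fun i hi hih => (hmax i hi hih).trans ?_⟩)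
  · exact score_le_score_iff.2 (score_le_score_iff.1 (hmax i hi (by omega)))
  · exact score_le_score_iff.2 (score_le_score_iff.1 (hmax₀ _ hlt hle'))

theorem sum_Ioc_add_sum_Ioc {r s t : ℕ} (hrs : r ≤ s) (hst : s ≤ t) :
    ∑ l ∈ Finset.Ioc r s, w l + ∑ l ∈ Finset.Ioc s t, w l = ∑ l ∈ Finset.Ioc r t, w l :=
  Finset.sum_Ioc_consecutive w hrs hst

/-- If the vertex `h + 1` would absorb all clusters beyond `r`, then these clusters cost at most
as much at `v (h + 1)` as the single merged cluster. -/
theorem costFrom_le_merged (hc : 0 < c) {h : ℕ} (hw : ∀ i, 1 ≤ i → i ≤ h → 0 < w i)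
    (N r : ℕ) (hr : r ≤ h)
    (hmerge : ∀ j, r < j → j ≤ h → τ * (v (h + 1) - v j) ≤ (∑ l ∈ Finset.Ioc j (h + 1), w l) / c) :
    costFrom τ c v w h (v (h + 1)) N r ≤ (∑ l ∈ Finset.Ioc r (h + 1), w l) ^ 2 / (2 * c) := by
  induction N generalizing r with
  | zero =>
    rw [costFrom_zero]
    positivity
  | succ N ih =>
    rw [costFrom_succ, clusterCost]
    have hrs := le_nextHead (τ := τ) (c := c) (v := v) (w := w) hr
    have hsh := nextHead_le (τ := τ) (c := c) (v := v) (w := w) hr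
    set s := nextHead τ c v w h r
    have hrec := ih s hsh fun j hj => hmerge j (hrs.trans_lt hj)
    rw [← sum_Ioc_add_sum_Ioc hrs (hsh.trans h.le_succ)]
    set σ := ∑ l ∈ Finset.Ioc r s, w l with hσ
    set T := ∑ l ∈ Finset.Ioc s (h + 1), w l with hT
    have hstep : σ * (τ * (v (h + 1) - v s)) ≤ σ * (T / c) := by
      rcases hrs.eq_or_lt with heq | hlt
      · simp [hσ, ← heq]
      · refine mul_le_mul_of_nonneg_left (hmerge s hlt hsh) (Finset.sum_nonneg fun l hl => ?_)
        rw [Finset.mem_Ioc] at hl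
        exact (hw l (by omega) (by omega)).le
    calc _ ≤ σ * (T / c) + σ ^ 2 / (2 * c) + T ^ 2 / (2 * c) := by gcongr
      _ = (σ + T) ^ 2 / (2 * c) := by field_simp; ring

/-- Adding a vertex located at the evaluation point does not decrease the left cost. -/
theorem costFrom_le_costFrom_succ (hc : 0 < c) {h : ℕ} (hw : ∀ i, 1 ≤ i → i ≤ h → 0 < w i)
    (N r : ℕ) (hr : r ≤ h) :
    costFrom τ c v w h (v (h + 1)) N r ≤ costFrom τ c v w (h + 1) (v (h + 1)) N r := by
  induction N generalizing r with
  | zero => simp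
  | succ N ih =>
    by_cases heq : nextHead τ c v w (h + 1) r = h + 1
    · have hmax := (nextHead_isGreatest (τ := τ) (c := c) (v := v) (w := w)
        (Nat.lt_add_one_of_le hr)).1.2
      have hzero : ∀ N, costFrom τ c v w (h + 1) (v (h + 1)) N (h + 1) = 0 := by
        intro N
        induction N with
        | zero => simp
        | succ N ih => simp [costFrom_succ, nextHead_self, clusterCost, ih]
      rw [costFrom_succ (h + 1), heq, hzero, clusterCost]
      simp only [sub_self, mul_zero, zero_add, add_zero]
      refine costFrom_le_merged hc hw _ r hr fun j hj hjh => ?_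
      have hscore := hmax j hj (by omega)
      rw [heq, score_le_score_iff,
        ← sum_Ioc_add_sum_Ioc hj.le (hjh.trans h.le_succ), add_div] at hscore
      linarith
    · rw [costFrom_succ, costFrom_succ, nextHead_succ_eq hr heq]
      gcongr
      exact ih _ (nextHead_le hr)

theorem hIdx_eq {n k : ℕ} {x : ℝ} (hk : k ≤ n) (hlt : ∀ i, 1 ≤ i → i ≤ k → v i < x)
    (hge : ∀ i, k < i → i ≤ n → x ≤ v i) : hIdx n v x = k := by
  have : (Finset.Icc 1 n).filter (fun i => v i < x) = Finset.Icc 1 k := by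
    ext i
    simp only [Finset.mem_filter, Finset.mem_Icc]
    constructor
    · rintro ⟨⟨h1, h2⟩, h3⟩
      refine ⟨h1, ?_⟩
      by_contra! h
      exact absurd (hge i h h2) (not_le.2 h3)
    · rintro ⟨h1, h2⟩
      exact ⟨⟨h1, h2.trans hk⟩, hlt i h1 h2⟩
  rw [hIdx, this, Nat.card_Icc, Nat.add_sub_cancel]

theorem strictMonoOn_Icc {n : ℕ} (hv : ∀ i, 1 ≤ i → i < n → v i < v (i + 1)) :
    StrictMonoOn v (Set.Icc 1 n) := by
  rintro i ⟨hi, -⟩ j ⟨-, hj⟩ hij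
  induction j, hij using Nat.le_induction with
  | base => exact hv i hi hj
  | succ k hk ih => exact (ih (by omega)).trans (hv k (by omega) (by omega))

/-- Between consecutive vertices `Φ_L` is affine, and its values at the two ends do not exceed
the values of the affine extension. -/
theorem exists_affine_phiL {n : ℕ} (hc : 0 < c) (hv : StrictMonoOn v (Set.Icc 1 n))
    (hw : ∀ i, 1 ≤ i → i ≤ n → 0 < w i) {k : ℕ} (hk : 1 ≤ k) (hkn : k < n) :
    ∃ a b : ℝ, (∀ x ∈ Set.Ioo (v k) (v (k + 1)), phiL n τ c v w x = a * x + b) ∧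
      phiL n τ c v w (v k) ≤ a * v k + b ∧
      phiL n τ c v w (v (k + 1)) ≤ a * v (k + 1) + b := by
  obtain ⟨a, b, hab⟩ := costFrom_eq_affine (τ := τ) (c := c) (v := v) (w := w) k n 0
  have hidx : ∀ x, v k < x → x ≤ v (k + 1) → hIdx n v x = k := fun x hx hx' =>
    hIdx_eq hkn.le
      (fun i hi hik => (hv.monotoneOn ⟨hi, by omega⟩ ⟨hk, hkn.le⟩ hik).trans_lt hx)
      (fun i hi hin => hx'.trans (hv.monotoneOn ⟨by omega, by omega⟩ ⟨by omega, hin⟩ hi))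
  refine ⟨a, b, fun x hx => ?_, ?_, ?_⟩
  · rw [phiL_eq_costFrom, hidx x hx.1 hx.2.le, hab]
  · obtain ⟨h, rfl⟩ : ∃ h, k = h + 1 := ⟨k - 1, by omega⟩
    have : hIdx n v (v (h + 1)) = h := hIdx_eq (by omega)
      (fun i hi hih => hv ⟨hi, by omega⟩ ⟨hk, hkn.le⟩ (by omega))
      (fun i hi hin => hv.monotoneOn ⟨hk, hkn.le⟩ ⟨by omega, hin⟩ hi)
    rw [phiL_eq_costFrom, this, ← hab]
    exact costFrom_le_costFrom_succ hc (fun i hi hih => hw i hi (by omega)) n 0 h.zero_le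
  · rw [phiL_eq_costFrom, hidx _ (hv ⟨hk, hkn.le⟩ ⟨by omega, hkn⟩ k.lt_succ_self) le_rfl, hab]

/-- Between consecutive vertices `Φ` is affine, and its values at the two ends do not exceed
the values of the affine extension. -/
theorem exists_affine_phi {n : ℕ} (hc : 0 < c) (hv : StrictMonoOn v (Set.Icc 1 n))
    (hw : ∀ i, 1 ≤ i → i ≤ n → 0 < w i) {k : ℕ} (hk : 1 ≤ k) (hkn : k < n) :
    ∃ a b : ℝ, (∀ x ∈ Set.Ioo (v k) (v (k + 1)), phi n τ c v w x = a * x + b) ∧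
      phi n τ c v w (v k) ≤ a * v k + b ∧
      phi n τ c v w (v (k + 1)) ≤ a * v (k + 1) + b := by
  have hrv : StrictMonoOn (rv n v) (Set.Icc 1 n) := by
    rintro i ⟨hi, hin⟩ j ⟨hj, hjn⟩ hij
    exact neg_lt_neg (hv ⟨by omega, by omega⟩ ⟨by omega, by omega⟩ (by omega))
  obtain ⟨a, b, hx, hl, hr⟩ := exists_affine_phiL (τ := τ) hc hv hw hk hkn
  obtain ⟨a', b', hx', hl', hr'⟩ :=
    exists_affine_phiL (τ := τ) (v := rv n v) (w := rw n w) hc hrv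
      (fun i hi hin => hw (n + 1 - i) (by omega) (by omega))
      (k := n - k) (by omega) (by omega)
  have h1 : rv n v (n - k) = -v (k + 1) := by
    rw [rv, show n + 1 - (n - k) = k + 1 by omega]
  have h2 : rv n v (n - k + 1) = -v k := by
    rw [rv, show n + 1 - (n - k + 1) = k by omega]
  rw [h1] at hx' hl'
  rw [h2] at hx' hr'
  refine ⟨a - a', b + b', fun x hxm => ?_, ?_, ?_⟩
  · rw [phi, phiR, hx x hxm, hx' (-x) ⟨neg_lt_neg hxm.2, neg_lt_neg hxm.1⟩]
    ring
  · rw [phi, phiR]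
    linarith
  · rw [phi, phiR]
    linarith

end

end DPN

open DPN

theorem stmt1 (n : ℕ) (τ c : ℝ) (hτ : 0 < τ) (hc : 0 < c) (v : ℕ → ℝ)
    (hv : ∀ i, 1 ≤ i → i < n → v i < v (i + 1)) (hn : 1 ≤ n)
    (w : ℕ → ℝ) (hw : ∀ i, 1 ≤ i → i ≤ n → 0 < w i) :
    ∃ i, 1 ≤ i ∧ i ≤ n ∧
      ∀ x ∈ Set.Icc (v 1) (v n), phi n τ c v w (v i) ≤ phi n τ c v w x := by
  have hmono := strictMonoOn_Icc hv
  obtain ⟨i, hi, hmin⟩ :=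
    Finset.exists_min_image (Finset.Icc 1 n) (fun i => phi n τ c v w (v i)) ⟨1, by simp [hn]⟩
  simp only [Finset.mem_Icc] at hi hmin
  refine ⟨i, hi.1, hi.2, fun x hx => ?_⟩
  obtain ⟨k, hk, hmax⟩ := Finset.exists_max_image
    ((Finset.Icc 1 n).filter (fun i => v i ≤ x)) id ⟨1, by simpa [hn] using hx.1⟩
  simp only [Finset.mem_filter, Finset.mem_Icc, id] at hk hmax
  obtain ⟨⟨hk1, hkn⟩, hkx⟩ := hk
  rcases hkx.eq_or_lt with rfl | hlt
  · exact hmin k ⟨hk1, hkn⟩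
  have hkn' : k < n := by
    refine lt_of_le_of_ne hkn ?_
    rintro rfl
    exact absurd hx.2 (not_le.2 hlt)
  have hxk : x < v (k + 1) := by
    by_contra! h
    exact absurd (hmax (k + 1) ⟨⟨by omega, hkn'⟩, h⟩) (by omega)
  obtain ⟨a, b, hab, hl, hr⟩ := exists_affine_phi (τ := τ) hc hmono hw hk1 hkn'
  rw [hab x ⟨hlt, hxk⟩]
  rcases le_total 0 a with ha | ha
  · have := mul_le_mul_of_nonneg_left hlt.le ha
    linarith [hmin k ⟨hk1, hkn⟩]
  · have := mul_le_mul_of_nonpos_left hxk.le ha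
    linarith [hmin (k + 1) ⟨by omega, hkn'⟩]
end

section
/- For any fixed positive weights w_1, …, w_n and any edge index i ∈ {1, …, n−1}, there exist real constants a_i and b_i such that Φ(x) = a_i·x + b_i for all x in the open interval (v_i, v_{i+1}); that is, Φ is an affine function of x on the interior of each edge. -/
open Finset
open scoped Classical

namespace DPN

theorem vertex_lt_iff {n i k : ℕ} {v : ℕ → ℝ} {x : ℝ}
    (hv : ∀ i, 1 ≤ i → i < n → v i < v (i + 1)) (hi1 : 1 ≤ i) (hin : i < n)
    (hx : x ∈ Set.Ioo (v i) (v (i + 1))) (hk1 : 1 ≤ k) (hkn : k ≤ n) :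
    (v k < x ↔ k ≤ i) ∧ (x < v k ↔ i < k) := by
  have hmono : ∀ {a b : ℕ}, 1 ≤ a → a ≤ b → b ≤ n → v a ≤ v b := by
    intro a b ha hab
    induction b, hab using Nat.le_induction with
    | base => exact fun _ => le_rfl
    | succ b hab ih => exact fun hb => (ih (by omega)).trans (hv b (by omega) (by omega)).le
  rcases le_or_gt k i with hki | hki
  · have hlt := (hmono hk1 hki hin.le).trans_lt hx.1
    exact ⟨iff_of_true hlt hki, iff_of_false hlt.not_gt hki.not_gt⟩
  · have hlt := hx.2.trans_le (hmono (by omega) hki hkn)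
    exact ⟨iff_of_false hlt.not_gt hki.not_ge, iff_of_true hlt hki⟩

theorem exists_phiL_affine_of_hIdx_eq {n : ℕ} (τ c : ℝ) (v w : ℕ → ℝ) {S : Set ℝ} (h : ℕ)
    (hS : ∀ x ∈ S, hIdx n v x = h) :
    ∃ a b : ℝ, ∀ x ∈ S, phiL n τ c v w x = a * x + b := by
  let σ : ℕ → ℝ := fun m =>
    ∑ l ∈ Finset.Ioc (heads τ c v w h m) (heads τ c v w h (m + 1)), w l
  refine ⟨∑ m ∈ Finset.range n, σ m * τ,
    ∑ m ∈ Finset.range n, (σ m ^ 2 / (2 * c) - σ m * τ * v (heads τ c v w h (m + 1))),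
    fun x hx => ?_⟩
  rw [phiL, hS x hx, Finset.sum_mul, ← Finset.sum_add_distrib]
  exact Finset.sum_congr rfl fun m _ => by ring

end DPN

open DPN

theorem stmt2 (n : ℕ) (τ c : ℝ) (hτ : 0 < τ) (hc : 0 < c) (v : ℕ → ℝ)
    (hv : ∀ i, 1 ≤ i → i < n → v i < v (i + 1))
    (w : ℕ → ℝ) (hw : ∀ i, 1 ≤ i → i ≤ n → 0 < w i)
    (i : ℕ) (hi1 : 1 ≤ i) (hin : i < n) :
    ∃ a b : ℝ, ∀ x ∈ Set.Ioo (v i) (v (i + 1)), phi n τ c v w x = a * x + b := by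
  obtain ⟨a, b, hL⟩ := exists_phiL_affine_of_hIdx_eq (n := n) τ c v w
    (S := Set.Ioo (v i) (v (i + 1))) i fun x hx => by
      have hfilter : (Finset.Icc 1 n).filter (fun k => v k < x) = Finset.Icc 1 i := by
        ext k
        simp only [Finset.mem_filter, Finset.mem_Icc]
        constructor
        · rintro ⟨⟨hk1, hkn⟩, hk⟩
          exact ⟨hk1, (vertex_lt_iff hv hi1 hin hx hk1 hkn).1.1 hk⟩
        · rintro ⟨hk1, hki⟩
          exact ⟨⟨hk1, by omega⟩, (vertex_lt_iff hv hi1 hin hx hk1 (by omega)).1.2 hki⟩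
      simp [hIdx, hfilter]
  obtain ⟨a', b', hR⟩ := exists_phiL_affine_of_hIdx_eq (n := n) τ c (rv n v) (DPN.rw n w)
    (S := {y | -y ∈ Set.Ioo (v i) (v (i + 1))}) (n - i) fun y hy => by
      have hfilter :
          (Finset.Icc 1 n).filter (fun k => rv n v k < y) = Finset.Icc 1 (n - i) := by
        ext k
        simp only [Finset.mem_filter, Finset.mem_Icc, rv, neg_lt]
        constructor
        · rintro ⟨⟨hk1, hkn⟩, hk⟩
          have := (vertex_lt_iff hv hi1 hin hy (k := n + 1 - k) (by omega) (by omega)).2.1 hk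
          omega
        · rintro ⟨hk1, hki⟩
          exact ⟨by omega,
            (vertex_lt_iff hv hi1 hin hy (by omega) (by omega)).2.2 (by omega)⟩
      simp [hIdx, hfilter]
  refine ⟨a - a', b + b', fun x hx => ?_⟩
  rw [phi, phiR, hL x hx, hR (-x) (by simpa using hx)]
  ring
end

section
/- Fix positive weights w_1, …, w_n, a point x ∈ [v_1, v_n], and an index i with v_i < x. Then there exists δ_0 > 0 such that for every δ ∈ (0, δ_0), the left cluster heads for x computed with the weights obtained from w by replacing w_i with w_i + δ (all other weights unchanged) coincide with the left cluster heads for x computed with the weights w. -/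
open Finset
open scoped Classical

open DPN

open scoped Topology

theorem nextHead_eq_of_isLast_max {τ c : ℝ} {v w : ℕ → ℝ} {h r J : ℕ}
    (hJ : J ∈ Finset.Ioc r h)
    (hmax : ∀ j ∈ Finset.Ioc r h, score τ c v w h r j ≤ score τ c v w h r J)
    (hlast : ∀ j ∈ Finset.Ioc r h, J < j → score τ c v w h r j < score τ c v w h r J) :
    nextHead τ c v w h r = J := by
  have key : ((Finset.Ioc r h).filter (fun j =>
      ∀ j' ∈ Finset.Ioc r h, score τ c v w h r j' ≤ score τ c v w h r j)).max = (J : WithBot ℕ) := by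
    apply le_antisymm
    · refine Finset.max_le fun j hj => WithBot.coe_le_coe.mpr ?_
      rw [Finset.mem_filter] at hj
      by_contra! hlt
      exact absurd (hj.2 J hJ) (not_le.mpr (hlast j hj.1 hlt))
    · exact Finset.le_max (Finset.mem_filter.mpr ⟨hJ, hmax⟩)
  unfold nextHead
  rw [key]
  rfl

theorem exists_last_max (f : ℕ → ℝ) {s : Finset ℕ} (hs : s.Nonempty) :
    ∃ J ∈ s, (∀ j ∈ s, f j ≤ f J) ∧ ∀ j ∈ s, J < j → f j < f J := by
  obtain ⟨a, ha, hmax⟩ := s.exists_max_image f hs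
  have hne : (s.filter (fun j => f a ≤ f j)).Nonempty :=
    ⟨a, Finset.mem_filter.mpr ⟨ha, le_rfl⟩⟩
  obtain ⟨hJs, hJ⟩ := Finset.mem_filter.mp (Finset.max'_mem _ hne)
  refine ⟨_, hJs, fun j hj => (hmax j hj).trans hJ, fun j hj hlt => ?_⟩
  by_contra! hle
  exact absurd (Finset.le_max' _ j (Finset.mem_filter.mpr ⟨hj, hJ.trans hle⟩)) (not_le.mpr hlt)

theorem score_update (τ c : ℝ) (v w : ℕ → ℝ) (h r i j : ℕ) (δ : ℝ) :
    score τ c v (Function.update w i (w i + δ)) h r j =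
      score τ c v w h r j + if i ∈ Finset.Ioc r j then δ / c else 0 := by
  unfold score
  split_ifs with hi
  · rw [Finset.sum_update_of_mem hi, ← Finset.sum_sdiff (Finset.singleton_subset_iff.mpr hi),
      Finset.sum_singleton]
    ring
  · rw [Finset.sum_update_of_notMem hi, add_zero]

theorem nextHead_update_of_le {τ c : ℝ} {v w : ℕ → ℝ} {h r i : ℕ} (hir : i ≤ r) (δ : ℝ) :
    nextHead τ c v (Function.update w i (w i + δ)) h r = nextHead τ c v w h r := by
  have hs : ∀ j, score τ c v (Function.update w i (w i + δ)) h r j = score τ c v w h r j := by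
    intro j
    rw [score_update, if_neg (by simp [hir]), add_zero]
  simp only [nextHead, hs]

theorem eventually_nextHead_update {τ c : ℝ} (hc : 0 < c) (v w : ℕ → ℝ) (h r i : ℕ) :
    ∀ᶠ δ in 𝓝[>] (0 : ℝ),
      nextHead τ c v (Function.update w i (w i + δ)) h r = nextHead τ c v w h r := by
  rcases (Finset.Ioc r h).eq_empty_or_nonempty with he | hne
  · simp [nextHead, he]
  obtain ⟨J, hJ, hmax, hlast⟩ := exists_last_max (score τ c v w h r) hne
  have hsmall : ∀ᶠ δ in 𝓝[>] (0 : ℝ), ∀ j ∈ Finset.Ioc r h, J < j →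
      score τ c v w h r j + δ / c < score τ c v w h r J := by
    refine (Finset.eventually_all _).mpr fun j hj => ?_
    by_cases hlt : J < j
    · have hcont : Continuous fun δ : ℝ => score τ c v w h r j + δ / c := by fun_prop
      have := hcont.continuousAt.eventually_lt (x₀ := 0) continuousAt_const
        (by simpa using hlast j hj hlt)
      exact (this.filter_mono nhdsWithin_le_nhds).mono fun _ hδ _ => hδ
    · simp [hlt]
  filter_upwards [hsmall, self_mem_nhdsWithin] with δ hδ hpos
  have hq : 0 < δ / c := div_pos hpos hc
  have hstrict : ∀ j ∈ Finset.Ioc r h, J < j →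
      score τ c v (Function.update w i (w i + δ)) h r j <
        score τ c v (Function.update w i (w i + δ)) h r J := by
    intro j hj hlt
    have := hδ j hj hlt
    simp only [score_update]
    split_ifs <;> linarith
  rw [nextHead_eq_of_isLast_max hJ hmax hlast]
  refine nextHead_eq_of_isLast_max hJ (fun j hj => ?_) hstrict
  rcases lt_or_ge J j with hlt | hle
  · exact (hstrict j hj hlt).le
  · have hscore := hmax j hj
    simp only [score_update]
    split_ifs with h₁ h₂
    · linarith
    · exact absurd (Finset.Ioc_subset_Ioc_right hle h₁) h₂
    · linarith
    · linarith

theorem stmt4 (n : ℕ) (τ c : ℝ) (hτ : 0 < τ) (hc : 0 < c) (v : ℕ → ℝ)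
    (hv : ∀ i, 1 ≤ i → i < n → v i < v (i + 1))
    (w : ℕ → ℝ) (hw : ∀ i, 1 ≤ i → i ≤ n → 0 < w i)
    (x : ℝ) (hx : x ∈ Set.Icc (v 1) (v n))
    (i : ℕ) (hi1 : 1 ≤ i) (hin : i ≤ n) (hix : v i < x) :
    ∃ δ₀ > (0 : ℝ), ∀ δ ∈ Set.Ioo (0 : ℝ) δ₀, ∀ m,
      heads τ c v (Function.update w i (w i + δ)) (hIdx n v x) m =
        heads τ c v w (hIdx n v x) m := by
  have hev : ∀ᶠ δ in 𝓝[>] (0 : ℝ), ∀ r ∈ Finset.range i,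
      nextHead τ c v (Function.update w i (w i + δ)) (hIdx n v x) r =
        nextHead τ c v w (hIdx n v x) r :=
    (Finset.eventually_all _).mpr fun r _ => eventually_nextHead_update hc v w _ r i
  obtain ⟨δ₀, hδ₀, hsub⟩ := mem_nhdsGT_iff_exists_Ioo_subset.mp hev
  refine ⟨δ₀, hδ₀, fun δ hδ m => ?_⟩
  induction m with
  | zero => rfl
  | succ m ih =>
    simp only [heads]
    rw [ih]
    rcases lt_or_ge (heads τ c v w (hIdx n v x) m) i with hlt | hle
    · exact hsub hδ _ (Finset.mem_range.mpr hlt)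
    · exact nextHead_update_of_le hle δ
end
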